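/- Let (V,⟨·,·⟩) be a 3-dimensional real inner product space and let S be a symmetric endomorphism of V with tr S = 0, with orthonormal eigenbasis {e₁,e₂,e₃} and eigenvalues λ₁,λ₂,λ₃. Define the linear map B: V → Λ²V*⊗V* by B(K)(x,y,z) = ⟨SK,x⟩⟨y,z⟩ − ⟨SK,y⟩⟨x,z⟩ + 2(⟨K,x⟩⟨Sy,z⟩ − ⟨K,y⟩⟨Sx,z⟩). Then B(K) = (λ₂−λ₃)⟨K,e₁⟩(e¹∧e²⊗e² + e³∧e¹⊗e³) + (λ₃−λ₁)⟨K,e₂⟩(e¹∧e²⊗e¹ + e²∧e³⊗e³) + (λ₁−λ₂)⟨K,e₃⟩(e³∧e¹⊗e¹ + e²∧e³⊗e²), and consequently B is injective if and only if λ₁, λ₂, λ₃ are pairwise distinct. -/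

import Mathlib

open scoped RealInnerProductSpace

theorem OrthonormalBasis.inner_map_eq_sum_of_eigen
    {ι V : Type*} [Fintype ι] [NormedAddCommGroup V] [InnerProductSpace ℝ V]
    {S : V →ₗ[ℝ] V} (hS : S.IsSymmetric) (b : OrthonormalBasis ι ℝ V)
    {lam : ι → ℝ} (heig : ∀ i, S (b i) = lam i • b i) (x y : V) :
    ⟪S x, y⟫ = ∑ i, lam i * ⟪b i, x⟫ * ⟪b i, y⟫ := by
  rw [← b.sum_inner_mul_inner (S x) y]
  refine Finset.sum_congr rfl fun i _ => ?_
  rw [hS x (b i), heig, real_inner_smul_right, real_inner_comm x]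

theorem OrthonormalBasis.trace_eq_sum_of_eigen
    {ι V : Type*} [Fintype ι] [NormedAddCommGroup V] [InnerProductSpace ℝ V]
    {S : V →ₗ[ℝ] V} (b : OrthonormalBasis ι ℝ V)
    {lam : ι → ℝ} (heig : ∀ i, S (b i) = lam i • b i) :
    LinearMap.trace ℝ V S = ∑ i, lam i := by
  rw [S.trace_eq_sum_inner b]
  simp [heig, real_inner_smul_right]

/-- the pointwise linear algebra of equation (5.12) of the
paper. Let `(V, ⟨·,·⟩)` be a 3-dimensional real inner product space and `S` a
symmetric trace-free endomorphism with orthonormal eigenbasis `{e₁,e₂,e₃}` and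
eigenvalues `λ₁,λ₂,λ₃`.  Define `B : V → Λ²V* ⊗ V*` by
`B(K)(x,y,z) = ⟨SK,x⟩⟨y,z⟩ - ⟨SK,y⟩⟨x,z⟩ + 2(⟨K,x⟩⟨Sy,z⟩ - ⟨K,y⟩⟨Sx,z⟩)`
(i.e. `B(K) = S(K)∧g + 2K∧S`).  Then `B(K)` has the displayed expression in
the eigenframe, and consequently `B` is injective if and only if
`λ₁, λ₂, λ₃` are pairwise distinct. -/
theorem bartnik_tod_genericity
    {V : Type*} [NormedAddCommGroup V] [InnerProductSpace ℝ V]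
    [FiniteDimensional ℝ V] (hdim : Module.finrank ℝ V = 3)
    (S : V →ₗ[ℝ] V) (hsymm : ∀ x y, ⟪S x, y⟫ = ⟪x, S y⟫)
    (htr : LinearMap.trace ℝ V S = 0)
    (b : OrthonormalBasis (Fin 3) ℝ V)
    (lam : Fin 3 → ℝ) (heig : ∀ i, S (b i) = lam i • b i)
    (B : V → V → V → V → ℝ)
    (hB : ∀ K x y z, B K x y z =
      ⟪S K, x⟫ * ⟪y, z⟫ - ⟪S K, y⟫ * ⟪x, z⟫
        + 2 * (⟪K, x⟫ * ⟪S y, z⟫ - ⟪K, y⟫ * ⟪S x, z⟫)) :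
    (∀ K x y z, B K x y z =
        (lam 1 - lam 2) * ⟪K, b 0⟫ *
          ((⟪b 0, x⟫ * ⟪b 1, y⟫ - ⟪b 0, y⟫ * ⟪b 1, x⟫) * ⟪b 1, z⟫
            + (⟪b 2, x⟫ * ⟪b 0, y⟫ - ⟪b 2, y⟫ * ⟪b 0, x⟫) * ⟪b 2, z⟫)
      + (lam 2 - lam 0) * ⟪K, b 1⟫ *
          ((⟪b 0, x⟫ * ⟪b 1, y⟫ - ⟪b 0, y⟫ * ⟪b 1, x⟫) * ⟪b 0, z⟫
            + (⟪b 1, x⟫ * ⟪b 2, y⟫ - ⟪b 1, y⟫ * ⟪b 2, x⟫) * ⟪b 2, z⟫)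
      + (lam 0 - lam 1) * ⟪K, b 2⟫ *
          ((⟪b 2, x⟫ * ⟪b 0, y⟫ - ⟪b 2, y⟫ * ⟪b 0, x⟫) * ⟪b 0, z⟫
            + (⟪b 1, x⟫ * ⟪b 2, y⟫ - ⟪b 1, y⟫ * ⟪b 2, x⟫) * ⟪b 1, z⟫)) ∧
    (Function.Injective B ↔ (lam 0 ≠ lam 1 ∧ lam 1 ≠ lam 2 ∧ lam 0 ≠ lam 2)) := by
  have hsum : lam 0 + lam 1 + lam 2 = 0 := by
    rw [← htr, b.trace_eq_sum_of_eigen heig, Fin.sum_univ_three]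
  have hform : ∀ K x y z, B K x y z =
        (lam 1 - lam 2) * ⟪K, b 0⟫ *
          ((⟪b 0, x⟫ * ⟪b 1, y⟫ - ⟪b 0, y⟫ * ⟪b 1, x⟫) * ⟪b 1, z⟫
            + (⟪b 2, x⟫ * ⟪b 0, y⟫ - ⟪b 2, y⟫ * ⟪b 0, x⟫) * ⟪b 2, z⟫)
      + (lam 2 - lam 0) * ⟪K, b 1⟫ *
          ((⟪b 0, x⟫ * ⟪b 1, y⟫ - ⟪b 0, y⟫ * ⟪b 1, x⟫) * ⟪b 0, z⟫
            + (⟪b 1, x⟫ * ⟪b 2, y⟫ - ⟪b 1, y⟫ * ⟪b 2, x⟫) * ⟪b 2, z⟫)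
      + (lam 0 - lam 1) * ⟪K, b 2⟫ *
          ((⟪b 2, x⟫ * ⟪b 0, y⟫ - ⟪b 2, y⟫ * ⟪b 0, x⟫) * ⟪b 0, z⟫
            + (⟪b 1, x⟫ * ⟪b 2, y⟫ - ⟪b 1, y⟫ * ⟪b 2, x⟫) * ⟪b 1, z⟫) := by
    intro K x y z
    have h2 : lam 2 = -lam 0 - lam 1 := by linarith
    have hg : ∀ u v : V, ⟪u, v⟫ = ∑ i, ⟪b i, u⟫ * ⟪b i, v⟫ := fun u v => by
      simp_rw [← b.sum_inner_mul_inner u v, real_inner_comm u]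
    rw [hB]
    simp only [b.inner_map_eq_sum_of_eigen hsymm heig]
    rw [hg y z, hg x z, hg K x, hg K y]
    simp only [Fin.sum_univ_three, real_inner_comm _ K, h2]
    ring
  have hb : ∀ i j, ⟪b i, b j⟫ = if i = j then (1 : ℝ) else 0 := fun i j =>
    orthonormal_iff_ite.mp b.orthonormal i j
  refine ⟨hform, fun hinj => ?_, fun ⟨h01, h12, h02⟩ K L hKL => ?_⟩
  · have hker : ∀ i, B (b i) ≠ B 0 := fun i h => b.toBasis.ne_zero i (by simpa using hinj h)
    refine ⟨fun h => hker 2 ?_, fun h => hker 0 ?_, fun h => hker 1 ?_⟩ <;>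
    · funext x y z
      rw [hform, hform]
      simp [hb, h]
  · have hcoord : ∀ x y z, B K x y z = B L x y z := fun x y z => by rw [hKL]
    have h0 : ⟪K, b 0⟫ = ⟪L, b 0⟫ := by
      simpa [hform, hb, sub_eq_zero, h12] using hcoord (b 0) (b 1) (b 1)
    have h1 : ⟪K, b 1⟫ = ⟪L, b 1⟫ := by
      simpa [hform, hb, sub_eq_zero, h02.symm] using hcoord (b 0) (b 1) (b 0)
    have h2 : ⟪K, b 2⟫ = ⟪L, b 2⟫ := by
      simpa [hform, hb, sub_eq_zero, h01] using hcoord (b 2) (b 0) (b 0)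
    refine InnerProductSpace.ext_inner_right_basis (𝕜 := ℝ) b.toBasis fun i => ?_
    fin_cases i <;> simpa
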